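/- Let G be a finite simple graph with |V(G)| ≥ 2δ(G)+1. Then the matching number of G satisfies α'(G) ≥ δ(G). -/

import Mathlib

namespace SimpleGraph

variable {V : Type*} {G : SimpleGraph V}

/-- An involution all of whose non-fixed points are moved along edges of `G`; its non-trivial orbits
are the edges of a matching. -/
structure IsMatchingInvolution (G : SimpleGraph V) (σ : V → V) : Prop where
  involutive : Function.Involutive σ
  adj : ∀ x, σ x ≠ x → G.Adj x (σ x)

namespace IsMatchingInvolution

variable {σ : V → V}

/-- The matching whose edges are the non-trivial orbits of a matching involution. -/
def toSubgraph (hσ : G.IsMatchingInvolution σ) : G.Subgraph where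
  verts := {x | σ x ≠ x}
  Adj x y := σ x = y ∧ x ≠ y
  adj_sub := by
    rintro x y ⟨rfl, hne⟩
    exact hσ.adj x hne.symm
  edge_vert := by
    rintro x y ⟨rfl, hne⟩
    exact hne.symm
  symm := ⟨by
    rintro x y ⟨rfl, hne⟩
    exact ⟨hσ.involutive x, hne.symm⟩⟩

theorem isMatching_toSubgraph (hσ : G.IsMatchingInvolution σ) : hσ.toSubgraph.IsMatching := by
  intro x hx
  exact ⟨σ x, ⟨rfl, Ne.symm hx⟩, fun y hy => hy.1.symm⟩

variable [Fintype V] [DecidableEq V]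

theorem card_support_le_two_mul_ncard_edgeSet (hσ : G.IsMatchingInvolution σ) :
    (Finset.univ.filter fun x => σ x ≠ x).card ≤ 2 * hσ.toSubgraph.edgeSet.ncard := by
  set S := Finset.univ.filter fun x => σ x ≠ x
  have himage : (S.image fun x => s(x, σ x)).card ≤ hσ.toSubgraph.edgeSet.ncard := by
    rw [← Set.ncard_coe_finset]
    refine Set.ncard_le_ncard ?_ (Set.toFinite _)
    intro e he
    obtain ⟨x, hx, rfl⟩ := Finset.mem_image.mp (Finset.mem_coe.mp he)
    exact ⟨rfl, Ne.symm (Finset.mem_filter.mp hx).2⟩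
  have hfiber : S.card ≤ 2 * (S.image fun x => s(x, σ x)).card := by
    refine Finset.card_le_mul_card_image S 2 fun e he => ?_
    obtain ⟨x, -, rfl⟩ := Finset.mem_image.mp he
    refine (Finset.card_le_card (t := {x, σ x}) fun y hy => ?_).trans Finset.card_le_two
    have hy' := (Finset.mem_filter.mp hy).2
    rw [Sym2.eq_iff] at hy'
    simp only [Finset.mem_insert, Finset.mem_singleton]
    exact hy'.imp And.left And.left
  lia

/-- Adding an edge between two unmatched vertices. -/
theorem exists_card_support_of_adj (hσ : G.IsMatchingInvolution σ) {u w : V} (hu : σ u = u)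
    (hw : σ w = w) (huw : G.Adj u w) :
    ∃ τ, G.IsMatchingInvolution τ ∧ (Finset.univ.filter fun x => τ x ≠ x).card =
      (Finset.univ.filter fun x => σ x ≠ x).card + 2 := by
  have hne := huw.ne
  have hinv := hσ.involutive
  refine ⟨fun z => if z = u then w else if z = w then u else σ z, ⟨fun z => ?_, fun z hz => ?_⟩, ?_⟩
  · have := hinv z
    grind
  · have := hσ.adj z
    have := huw.symm
    grind
  · rw [← Finset.card_pair hne, ← Finset.card_union_of_disjoint]
    · congr 1
      ext z
      simp only [Finset.mem_filter, Finset.mem_univ, true_and, Finset.mem_union, Finset.mem_insert,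
        Finset.mem_singleton]
      grind
    · rw [Finset.disjoint_left]
      simp only [Finset.mem_filter, Finset.mem_univ, true_and, Finset.mem_insert,
        Finset.mem_singleton]
      grind

/-- Augmenting along the path `u, x, σ x, v` with unmatched ends. -/
theorem exists_card_support_of_path (hσ : G.IsMatchingInvolution σ) {u v x : V} (huv : u ≠ v)
    (hu : σ u = u) (hv : σ v = v) (hx : σ x ≠ x) (hux : G.Adj u x) (hvx : G.Adj v (σ x)) :
    ∃ τ, G.IsMatchingInvolution τ ∧ (Finset.univ.filter fun x => τ x ≠ x).card =
      (Finset.univ.filter fun x => σ x ≠ x).card + 2 := by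
  have hinv := hσ.involutive
  have hσx := hinv x
  refine ⟨fun z => if z = u then x else if z = x then u else if z = v then σ x else
    if z = σ x then v else σ z, ⟨fun z => ?_, fun z hz => ?_⟩, ?_⟩
  · have := hinv z
    grind
  · have := hσ.adj z
    have := hux.symm
    have := hvx.symm
    grind
  · rw [← Finset.card_pair huv, ← Finset.card_union_of_disjoint]
    · congr 1
      ext z
      simp only [Finset.mem_filter, Finset.mem_univ, true_and, Finset.mem_union, Finset.mem_insert,
        Finset.mem_singleton]
      have := hinv z
      grind
    · rw [Finset.disjoint_left]
      simp only [Finset.mem_filter, Finset.mem_univ, true_and, Finset.mem_insert,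
        Finset.mem_singleton]
      grind

/-- A matching covering fewer than `2 * G.minDegree` vertices and missing at least two can be
augmented. -/
theorem exists_card_support_of_lt [DecidableRel G.Adj] (hσ : G.IsMatchingInvolution σ)
    (hlt : (Finset.univ.filter fun x => σ x ≠ x).card < 2 * G.minDegree)
    (hcard : (Finset.univ.filter fun x => σ x ≠ x).card + 2 ≤ Fintype.card V) :
    ∃ τ, G.IsMatchingInvolution τ ∧ (Finset.univ.filter fun x => τ x ≠ x).card =
      (Finset.univ.filter fun x => σ x ≠ x).card + 2 := by
  by_cases hadj : ∃ u w, σ u = u ∧ σ w = w ∧ G.Adj u w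
  · obtain ⟨u, w, hu, hw, huw⟩ := hadj
    exact hσ.exists_card_support_of_adj hu hw huw
  push Not at hadj
  set S := Finset.univ.filter fun x => σ x ≠ x with hS
  obtain ⟨u, hu, v, hv, huv⟩ : ∃ u ∈ Sᶜ, ∃ v ∈ Sᶜ, u ≠ v := by
    rw [← Finset.one_lt_card, Finset.card_compl]
    lia
  have hu' : σ u = u := by simpa [hS] using hu
  have hv' : σ v = v := by simpa [hS] using hv
  have hmem (a w : V) (ha : σ a = a) (haw : G.Adj a w) : σ w ≠ w :=
    fun hw => hadj a w ha hw haw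
  have hdisj : ¬ Disjoint (G.neighborFinset u) ((G.neighborFinset v).image σ) := by
    intro hd
    have hsub : G.neighborFinset u ∪ (G.neighborFinset v).image σ ⊆ S := by
      refine Finset.union_subset (fun w hw => ?_) (fun w hw => ?_)
      · simpa [hS] using hmem u w hu' (by simpa using hw)
      · obtain ⟨y, hy, rfl⟩ := Finset.mem_image.mp hw
        have := hmem v y hv' (by simpa using hy)
        simpa [hS, hσ.involutive y] using this.symm
    have hle := Finset.card_le_card hsub
    rw [Finset.card_union_of_disjoint hd, Finset.card_image_of_injective _ hσ.involutive.injective,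
      card_neighborFinset_eq_degree, card_neighborFinset_eq_degree] at hle
    have := G.minDegree_le_degree u
    have := G.minDegree_le_degree v
    lia
  obtain ⟨x, hux, hx⟩ := Finset.not_disjoint_iff.mp hdisj
  obtain ⟨y, hvy, rfl⟩ := Finset.mem_image.mp hx
  rw [mem_neighborFinset] at hux hvy
  exact hσ.exists_card_support_of_path huv hu' hv' (hmem u _ hu' hux) hux
    (by rwa [hσ.involutive y])

end IsMatchingInvolution

theorem exists_isMatchingInvolution_card_support [Fintype V] [DecidableEq V] [DecidableRel G.Adj]
    (h : 2 * G.minDegree ≤ Fintype.card V) {k : ℕ} (hk : k ≤ G.minDegree) :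
    ∃ σ, G.IsMatchingInvolution σ ∧ (Finset.univ.filter fun x => σ x ≠ x).card = 2 * k := by
  induction k with
  | zero => exact ⟨id, ⟨fun _ => rfl, fun _ hx => absurd rfl hx⟩, by simp⟩
  | succ k ih =>
    obtain ⟨σ, hσ, hcard⟩ := ih (by lia)
    obtain ⟨τ, hτ, hcard'⟩ := hσ.exists_card_support_of_lt (by lia) (by lia)
    exact ⟨τ, hτ, by lia⟩

end SimpleGraph

theorem matching_number_ge_minDegree_of_card_ge
    {V : Type*} [Fintype V] (G : SimpleGraph V) [DecidableRel G.Adj]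
    (h : 2 * G.minDegree + 1 ≤ Fintype.card V) :
    ∃ M : G.Subgraph, M.IsMatching ∧ G.minDegree ≤ M.edgeSet.ncard := by
  classical
  obtain ⟨σ, hσ, hcard⟩ := SimpleGraph.exists_isMatchingInvolution_card_support
    (G := G) (by lia) le_rfl
  have hle := hσ.card_support_le_two_mul_ncard_edgeSet
  exact ⟨hσ.toSubgraph, hσ.isMatching_toSubgraph, by lia⟩
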